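/- (Classification of rank 2 square-zero supercharges in the 3d N=4 supersymmetry algebra: exactly two orbits, the A-twist and the B-twist.) Let 𝒮 be the set of complex 2×4 matrices Q with Q·Qᵀ = 0 and rank Q = 2, and let SL(2,ℂ) × SO(4,ℂ) act on 𝒮 by (g,h)·Q := g·Q·h⁻¹, where SO(4,ℂ) := {h ∈ M₄(ℂ) : h·hᵀ = 1₄ and det h = 1}. Then this action has exactly two orbits: there exist Q₁, Q₂ ∈ 𝒮 lying in different orbits such that every element of 𝒮 lies in the orbit of Q₁ or of Q₂. -/

import Mathlib

/-!
Statement 15 (classification of rank 2 square-zero supercharges in the 3d N=4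
supersymmetry algebra): the action of `SL(2,ℂ) × SO(4,ℂ)` on the set of complex 2×4
matrices `Q` with `Q·Qᵀ = 0` and `rank Q = 2`, given by `(g,h)·Q = g·Q·h⁻¹`, has
exactly two orbits.
-/

namespace Stmt15

open Matrix

/-- `Q'` lies in the `SL(2,ℂ) × SO(4,ℂ)`-orbit of `Q` under `(g,h)·Q = g·Q·h⁻¹`. -/
def InOrbit (Q Q' : Matrix (Fin 2) (Fin 4) ℂ) : Prop :=
  ∃ (g : Matrix (Fin 2) (Fin 2) ℂ) (h : Matrix (Fin 4) (Fin 4) ℂ),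
    g.det = 1 ∧ h * hᵀ = 1 ∧ h.det = 1 ∧ Q' = g * Q * h⁻¹

/-- `R` spans a Lagrangian complement to the span of the rows of `Q`, with the dual basis. -/
structure IsDualLagrangian (Q R : Matrix (Fin 2) (Fin 4) ℂ) : Prop where
  left_isotropic : Q * Qᵀ = 0
  right_isotropic : R * Rᵀ = 0
  pairing : Q * Rᵀ = 1

namespace IsDualLagrangian

variable {Q R Q' R' : Matrix (Fin 2) (Fin 4) ℂ}

theorem pairing_symm (H : IsDualLagrangian Q R) : R * Qᵀ = 1 := by
  simpa using congrArg transpose H.pairing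

theorem fromRows_mul_fromCols (H : IsDualLagrangian Q R) :
    fromRows Q R * fromCols Rᵀ Qᵀ = 1 := by
  rw [Matrix.fromRows_mul_fromCols, H.left_isotropic, H.right_isotropic, H.pairing, H.pairing_symm,
    fromBlocks_one]

theorem fromCols_mul_fromRows (H : IsDualLagrangian Q R) :
    fromCols Rᵀ Qᵀ * fromRows Q R = 1 :=
  (mul_eq_one_comm_of_card_eq _ _ _ (by simp)).1 H.fromRows_mul_fromCols

theorem resolution (H : IsDualLagrangian Q R) : Rᵀ * Q + Qᵀ * R = 1 := by
  rw [← H.fromCols_mul_fromRows, Matrix.fromCols_mul_fromRows]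

theorem rank_eq_two (H : IsDualLagrangian Q R) : Q.rank = 2 := by
  refine le_antisymm (by simpa using Q.rank_le_height) ?_
  have h := rank_mul_le_left Q Rᵀ
  rwa [H.pairing, rank_one, Fintype.card_fin] at h

/-- Any two isotropic frames are related by an orthogonal matrix. -/
theorem exists_orthogonal (H : IsDualLagrangian Q R) (H' : IsDualLagrangian Q' R') :
    ∃ h : Matrix (Fin 4) (Fin 4) ℂ, h * hᵀ = 1 ∧ Q * h = Q' := by
  refine ⟨Rᵀ * Q' + Qᵀ * R', ?_, ?_⟩
  · rw [mul_eq_one_comm, ← H'.resolution]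
    calc _ = Q'ᵀ * (R * Rᵀ) * Q' + Q'ᵀ * (R * Qᵀ) * R' + R'ᵀ * (Q * Rᵀ) * Q'
          + R'ᵀ * (Q * Qᵀ) * R' := by
          simp only [transpose_add, transpose_mul, transpose_transpose, Matrix.add_mul,
            Matrix.mul_add, Matrix.mul_assoc]
          abel
      _ = _ := by
          simp [H.left_isotropic, H.right_isotropic, H.pairing, H.pairing_symm, add_comm]
  · rw [Matrix.mul_add, ← Matrix.mul_assoc, ← Matrix.mul_assoc, H.pairing, H.left_isotropic]
    simp

/-- An orthogonal matrix preserving a Lagrangian subspace has determinant one. -/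
theorem det_eq_one_of_mul_eq (H : IsDualLagrangian Q R) {g : Matrix (Fin 2) (Fin 2) ℂ}
    {k : Matrix (Fin 4) (Fin 4) ℂ} (hk : k * kᵀ = 1) (hQ : Q * k = g * Q) : k.det = 1 := by
  have hc : R * k * Qᵀ * gᵀ = 1 := by
    have h : Qᵀ * gᵀ = kᵀ * Qᵀ := by simpa using (congrArg transpose hQ).symm
    rw [Matrix.mul_assoc _ Qᵀ, h, Matrix.mul_assoc R, ← Matrix.mul_assoc k, hk, Matrix.one_mul,
      H.pairing_symm]
  rw [← det_conj_of_mul_eq_one H.fromRows_mul_fromCols H.fromCols_mul_fromRows (N := k),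
    fromRows_mul, Matrix.fromRows_mul_fromCols, hQ, Matrix.mul_assoc g, Matrix.mul_assoc g,
    H.pairing, H.left_isotropic, Matrix.mul_zero, Matrix.mul_one, det_fromBlocks_zero₁₂,
    mul_comm, ← det_transpose g, ← det_mul, hc, det_one]

end IsDualLagrangian

theorem exists_isDualLagrangian {Q : Matrix (Fin 2) (Fin 4) ℂ} (hQ : Q * Qᵀ = 0)
    (hr : Q.rank = 2) : ∃ R, IsDualLagrangian Q R := by
  obtain ⟨S, hS⟩ : ∃ S : Matrix (Fin 4) (Fin 2) ℂ, Q * S = 1 := by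
    rw [← mulVec_surjective_iff_exists_right_inverse]
    have : LinearMap.range Q.mulVecLin = ⊤ :=
      Submodule.eq_top_of_finrank_eq (by rw [← Matrix.rank, hr]; simp)
    exact LinearMap.range_eq_top.1 this
  have hS' : Sᵀ * Qᵀ = 1 := by simpa using congrArg transpose hS
  have h₁ : Q * (Sᵀ - (1 / 2 : ℂ) • (Sᵀ * S * Q))ᵀ = 1 := by
    simp only [transpose_sub, transpose_smul, transpose_mul, transpose_transpose,
      Matrix.mul_sub, Matrix.mul_smul, hS]
    rw [← Matrix.mul_assoc, hQ]
    simp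
  refine ⟨Sᵀ - (1 / 2 : ℂ) • (Sᵀ * S * Q), hQ, ?_, h₁⟩
  rw [Matrix.sub_mul, Matrix.smul_mul, Matrix.mul_assoc _ Q, h₁]
  simp only [transpose_sub, transpose_smul, transpose_mul, transpose_transpose,
      Matrix.mul_sub, Matrix.mul_smul, Matrix.mul_one]
  rw [← Matrix.mul_assoc, hS', Matrix.one_mul, sub_sub, ← add_smul]
  norm_num

theorem inOrbit_of_mul_eq {Q Q' : Matrix (Fin 2) (Fin 4) ℂ} {h : Matrix (Fin 4) (Fin 4) ℂ}
    (hh : h * hᵀ = 1) (hd : h.det = 1) (hQ : Q * h = Q') : InOrbit Q Q' := by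
  refine ⟨1, hᵀ, det_one, ?_, by rwa [det_transpose], ?_⟩
  · rwa [transpose_transpose, mul_eq_one_comm]
  · rw [inv_eq_left_inv hh, Matrix.one_mul, hQ]

/-- The reflection in the last coordinate. -/
def reflection : Matrix (Fin 4) (Fin 4) ℂ := diagonal ![1, 1, 1, -1]

theorem reflection_transpose : reflectionᵀ = reflection := diagonal_transpose _

theorem reflection_mul_self : reflection * reflection = 1 := by
  rw [reflection, diagonal_mul_diagonal, ← diagonal_one]
  congr 1
  funext i
  fin_cases i <;> simp

theorem det_reflection : reflection.det = -1 := by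
  simp [reflection, Fin.prod_univ_four]

theorem reflection_mul_orthogonal {h : Matrix (Fin 4) (Fin 4) ℂ} (hh : h * hᵀ = 1) :
    reflection * h * (reflection * h)ᵀ = 1 := by
  rw [transpose_mul, reflection_transpose, Matrix.mul_assoc, ← Matrix.mul_assoc h, hh,
    Matrix.one_mul, reflection_mul_self]

theorem IsDualLagrangian.mul_reflection {Q R : Matrix (Fin 2) (Fin 4) ℂ}
    (H : IsDualLagrangian Q R) : IsDualLagrangian (Q * reflection) (R * reflection) := by
  have key (A B : Matrix (Fin 2) (Fin 4) ℂ) :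
      A * reflection * (B * reflection)ᵀ = A * Bᵀ := by
    rw [transpose_mul, reflection_transpose, Matrix.mul_assoc, ← Matrix.mul_assoc reflection,
      reflection_mul_self, Matrix.one_mul]
  exact ⟨by rw [key, H.left_isotropic], by rw [key, H.right_isotropic], by rw [key, H.pairing]⟩

theorem isDualLagrangian_standard :
    IsDualLagrangian !![1, Complex.I, 0, 0; 0, 0, 1, Complex.I]
      !![1 / 2, -Complex.I / 2, 0, 0; 0, 0, 1 / 2, -Complex.I / 2] := by
  constructor <;> ext i j <;> fin_cases i <;> fin_cases j <;>
    simp [Matrix.mul_apply, Fin.sum_univ_four] <;> ring_nf <;> norm_num [Complex.I_sq]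

theorem two_orbits_3d_N4 :
    ∃ Q₁ Q₂ : Matrix (Fin 2) (Fin 4) ℂ,
      (Q₁ * Q₁ᵀ = 0 ∧ Q₁.rank = 2) ∧
      (Q₂ * Q₂ᵀ = 0 ∧ Q₂.rank = 2) ∧
      ¬ InOrbit Q₁ Q₂ ∧
      (∀ Q : Matrix (Fin 2) (Fin 4) ℂ, Q * Qᵀ = 0 → Q.rank = 2 →
        InOrbit Q₁ Q ∨ InOrbit Q₂ Q) := by
  have H := isDualLagrangian_standard
  have H' := H.mul_reflection
  refine ⟨_, _, ⟨H.left_isotropic, H.rank_eq_two⟩, ⟨H'.left_isotropic, H'.rank_eq_two⟩, ?_, ?_⟩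
  · rintro ⟨g, h, -, hh, hd, hQ⟩
    have hk := H.det_eq_one_of_mul_eq (g := g) (reflection_mul_orthogonal hh) (by
      rw [← Matrix.mul_assoc, hQ, Matrix.mul_assoc, nonsing_inv_mul h (by simp [hd]),
        Matrix.mul_one])
    rw [det_mul, det_reflection, hd] at hk
    norm_num at hk
  · intro Q hQ hr
    obtain ⟨R, HR⟩ := exists_isDualLagrangian hQ hr
    obtain ⟨h, hh, hQh⟩ := H.exists_orthogonal HR
    have hsq : h.det * h.det = 1 := by simpa using congrArg det hh
    rcases mul_self_eq_one_iff.1 hsq with hd | hd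
    · exact Or.inl (inOrbit_of_mul_eq hh hd hQh)
    · refine Or.inr (inOrbit_of_mul_eq (reflection_mul_orthogonal hh)
        (by rw [det_mul, det_reflection, hd]; norm_num) ?_)
      rw [Matrix.mul_assoc, ← Matrix.mul_assoc reflection, reflection_mul_self, Matrix.one_mul,
        hQh]

end Stmt15
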